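/- arXiv:1311.1106 — 2 statements merged into one kernel-verified Lean document; each statement's English description precedes it below -/
import Mathlib

section
/- Let ρ : SL(2,ℝ) → GL(V) be a finite-dimensional real linear representation. Fix a > 1 and let a_t = diag(a^t, a^{-t}). Define V⁺, V⁰, V⁻ as the sums of positive, zero, and negative weight spaces for the diagonal action. If v ∈ V⁻ and v ≠ 0, then for any r ≠ 0, the projection q⁺(ρ(u_r)v) onto V⁺ is nonzero, where u_r = [[1,r],[0,1]]. -/
open Filter Topology

/-- Basic `SL(2,ℝ)` lemma: for a finite-dimensional real representation `ρ` of
`SL(2,ℝ)` with expanding/fixed/contracting subspaces `V⁺, V⁰, V⁻` for the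
diagonal flow `a_t = diag(aᵗ, a⁻ᵗ)` (`a > 1`), if `v ∈ V⁻` is nonzero and `r ≠ 0`,
then the projection `q⁺(ρ(u_r) v)` onto `V⁺` is nonzero, where `u_r = [[1,r],[0,1]]`. -/
theorem sl2_basic_lemma_qplus
    (V : Type*) [NormedAddCommGroup V] [NormedSpace ℝ V] [FiniteDimensional ℝ V]
    (ρ : Matrix.SpecialLinearGroup (Fin 2) ℝ →* (V →ₗ[ℝ] V)ˣ)
    (a : ℝ) (ha : 1 < a)
    (A : ℝ → Matrix.SpecialLinearGroup (Fin 2) ℝ)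
    (hA : ∀ t : ℝ, (A t : Matrix (Fin 2) (Fin 2) ℝ) = !![a ^ t, 0; 0, a ^ (-t)])
    (Vp V0 Vm : Submodule ℝ V)
    (hVp : ∀ v : V, v ∈ Vp ↔
      Tendsto (fun t : ℝ => (ρ (A t) : V →ₗ[ℝ] V) v) atBot (𝓝 0))
    (hV0 : ∀ v : V, v ∈ V0 ↔ ∀ t : ℝ, (ρ (A t) : V →ₗ[ℝ] V) v = v)
    (hVm : ∀ v : V, v ∈ Vm ↔
      Tendsto (fun t : ℝ => (ρ (A t) : V →ₗ[ℝ] V) v) atTop (𝓝 0))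
    (qp : V →ₗ[ℝ] V)
    (hqp : ∀ v : V, qp v ∈ Vp ∧ v - qp v ∈ V0 ⊔ Vm)
    (v : V) (hv : v ∈ Vm) (hv0 : v ≠ 0) (r : ℝ) (hr : r ≠ 0) :
    qp ((ρ ⟨!![1, r; 0, 1], by simp [Matrix.det_fin_two_of]⟩ : V →ₗ[ℝ] V) v) ≠ 0 := by
  classical
  have hap : 0 < a := by linarith
  let P : Matrix.SpecialLinearGroup (Fin 2) ℝ → V →L[ℝ] V :=
    fun g => LinearMap.toContinuousLinearMap (ρ g : V →ₗ[ℝ] V)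
  have hP : ∀ g x, (ρ g : V →ₗ[ℝ] V) x = P g x := fun g x => rfl
  have hPm : ∀ g h x, P (g * h) x = P g (P h x) := by
    intro g h x
    simp [← hP]
  have hP1 : ∀ x, P 1 x = x := by
    intro x
    simp [← hP]
  simp only [hP] at hVp hV0 hVm ⊢
  let n : ℝ → Matrix.SpecialLinearGroup (Fin 2) ℝ :=
    fun s => ⟨!![1, 0; s, 1], by simp [Matrix.det_fin_two_of]⟩
  let w : Matrix.SpecialLinearGroup (Fin 2) ℝ :=
    ⟨!![0, r; -r⁻¹, 0], by simp [Matrix.det_fin_two_of, hr]⟩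
  have hAadd : ∀ s t, A (s + t) = A s * A t := by
    intro s t
    apply Subtype.ext
    rw [Matrix.SpecialLinearGroup.coe_mul, hA, hA, hA]
    simp [Real.rpow_add hap, mul_comm]
  have hA0 : A 0 = 1 := by
    apply Subtype.ext
    rw [hA]
    simp [Matrix.one_fin_two]
  have hnadd : ∀ s t, n (s + t) = n s * n t := by
    intro s t
    apply Subtype.ext
    rw [Matrix.SpecialLinearGroup.coe_mul]
    simp [n]
  have hn0 : n 0 = 1 := by
    apply Subtype.ext
    simp [n, Matrix.one_fin_two]
  have hAn : ∀ t s, A t * n s = n (s * a ^ (-(2 * t))) * A t := by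
    intro t s
    apply Subtype.ext
    rw [Matrix.SpecialLinearGroup.coe_mul, Matrix.SpecialLinearGroup.coe_mul, hA]
    have : a ^ (-t) = a ^ (-(2 * t)) * a ^ t := by
      rw [← Real.rpow_add hap]; congr 1; ring
    simp [n, this]
    ring
  have hAw : ∀ t, A t * w = w * A (-t) := by
    intro t
    apply Subtype.ext
    rw [Matrix.SpecialLinearGroup.coe_mul, Matrix.SpecialLinearGroup.coe_mul, hA, hA]
    simp [w, mul_comm]
  have hu : (⟨!![1, r; 0, 1], by simp [Matrix.det_fin_two_of]⟩ :
      Matrix.SpecialLinearGroup (Fin 2) ℝ) = n r⁻¹ * (w * n r⁻¹) := by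
    apply Subtype.ext
    rw [Matrix.SpecialLinearGroup.coe_mul, Matrix.SpecialLinearGroup.coe_mul]
    simp [n, w, hr]
  -- local boundedness of the diagonal flow
  have hdec : ∀ x : V, ∃ p ∈ Vp, ∃ z ∈ V0, ∃ m ∈ Vm, x = p + z + m := by
    intro x
    obtain ⟨h1, h2⟩ := hqp x
    obtain ⟨z, hz, m, hm, h⟩ := Submodule.mem_sup.1 h2
    refine ⟨_, h1, z, hz, m, hm, ?_⟩
    rw [add_assoc, h]; abel
  have hloc : ∀ M : ℝ, ∀ x : V, ∃ C, ∀ t : Set.Icc (-M) M, ‖P (A t) x‖ ≤ C := by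
    intro M x
    obtain ⟨p, hp, z, hz, m, hm, rfl⟩ := hdec x
    have e1 : ∀ y : V, ∀ T : ℝ, (∀ t ∈ Set.Icc (-M) M, ‖P (A (T + t)) y‖ ≤ 1) →
        ∀ t ∈ Set.Icc (-M) M, ‖P (A t) y‖ ≤ ‖P (A (-T))‖ := by
      intro y T h t ht
      have : P (A t) y = P (A (-T)) (P (A (T + t)) y) := by
        rw [← hPm, ← hAadd]; congr 3; ring
      rw [this]
      refine ((P (A (-T))).le_opNorm _).trans ?_
      exact mul_le_of_le_one_right (norm_nonneg _) (h t ht)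
    have hm1 := ((hVm m).1 hm).norm
    have hp1 := ((hVp p).1 hp).norm
    rw [norm_zero] at hm1 hp1
    obtain ⟨T1, hT1⟩ := eventually_atTop.1 (hm1.eventually_le_const zero_lt_one)
    obtain ⟨T2, hT2⟩ := eventually_atBot.1 (hp1.eventually_le_const zero_lt_one)
    refine ⟨‖P (A (-(T2 - M)))‖ + ‖z‖ + ‖P (A (-(T1 + M)))‖, ?_⟩
    rintro ⟨t, ht⟩
    have b1 := e1 m (T1 + M) (fun t ht => hT1 _ (by linarith [ht.1])) t ht
    have b2 := e1 p (T2 - M) (fun t ht => hT2 _ (by linarith [ht.2])) t ht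
    simp only [map_add]
    rw [(hV0 z).1 hz t]
    refine (norm_add₃_le).trans ?_
    linarith
  have hlocU : ∀ M : ℝ, ∃ C, ∀ t ∈ Set.Icc (-M) M, ‖P (A t)‖ ≤ C := by
    intro M
    obtain ⟨C, hC⟩ := banach_steinhaus (g := fun t : Set.Icc (-M) M => P (A t)) (hloc M)
    exact ⟨C, fun t ht => hC ⟨t, ht⟩⟩
  -- local boundedness of the lower unipotent group
  have hnb : ∃ C, 0 ≤ C ∧ ∀ s : ℝ, |s| ≤ 1 → ∀ x, ‖P (n s) x‖ ≤ C * ‖x‖ := by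
    obtain ⟨C, hC⟩ := hlocU (Real.logb a 3)
    have hl3 : 0 ≤ Real.logb a 3 := Real.logb_nonneg ha (by norm_num)
    have hC0 : 0 ≤ C := (norm_nonneg _).trans (hC 0 ⟨by linarith, hl3⟩)
    refine ⟨C * ‖P (n 1)‖ * C * ‖P (n (-2))‖, by positivity, ?_⟩
    intro s hs x
    obtain ⟨hs1, hs2⟩ := abs_le.1 hs
    set t : ℝ := -(Real.logb a (s + 2)) / 2 with ht
    have l0 : 0 ≤ Real.logb a (s + 2) := Real.logb_nonneg ha (by linarith)
    have l1 : Real.logb a (s + 2) ≤ Real.logb a 3 :=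
      Real.logb_le_logb_of_le ha (by linarith) (by linarith)
    have c1 := hC t ⟨by linarith, by linarith⟩
    have c2 := hC (-t) ⟨by linarith, by linarith⟩
    have hpow : (1 : ℝ) * a ^ (-(2 * t)) = s + 2 := by
      have : -(2 * t) = Real.logb a (s + 2) := by rw [ht]; ring
      rw [this, one_mul, Real.rpow_logb hap ha.ne' (by linarith)]
    have key : n s = A t * (n 1 * (A (-t) * n (-2))) := by
      have h1 := hAn t 1
      rw [hpow] at h1
      rw [← mul_assoc, h1, mul_assoc, ← mul_assoc (A t), ← hAadd, add_neg_cancel, hA0, one_mul,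
        ← hnadd]
      congr 1; ring
    rw [key, hPm, hPm, hPm]
    calc ‖P (A t) (P (n 1) (P (A (-t)) (P (n (-2)) x)))‖
        ≤ C * (‖P (n 1)‖ * (C * (‖P (n (-2))‖ * ‖x‖))) := by
          refine (P (A t)).le_of_opNorm_le_of_le c1 ?_
          refine (P (n 1)).le_opNorm_of_le ?_
          refine (P (A (-t))).le_of_opNorm_le_of_le c2 ?_
          exact (P (n (-2))).le_opNorm _
      _ = _ := by ring
  obtain ⟨C, hC0, hC⟩ := hnb
  have hsmall : ∀ s : ℝ, ∀ᶠ t : ℝ in atTop, |s * a ^ (-(2 * t))| ≤ 1 := by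
    intro s
    have h1 : Tendsto (fun t : ℝ => a ^ (-(2 * t))) atTop (𝓝 0) := by
      have h2 : Tendsto (fun t : ℝ => -(2 * t)) atTop atBot :=
        tendsto_neg_atTop_atBot.comp (tendsto_id.const_mul_atTop (by norm_num : (0 : ℝ) < 2))
      exact (tendsto_rpow_atBot_of_base_gt_one a ha).comp h2
    have h3 := (h1.const_mul s).abs
    rw [mul_zero, abs_zero] at h3
    exact h3.eventually_le_const zero_lt_one
  have hbound : ∀ s x, ∀ᶠ t : ℝ in atTop, ‖P (A t) (P (n s) x)‖ ≤ C * ‖P (A t) x‖ := by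
    intro s x
    filter_upwards [hsmall s] with t ht
    rw [← hPm, hAn, hPm]
    exact hC _ ht _
  have hnVm : ∀ s, ∀ x ∈ Vm, P (n s) x ∈ Vm := by
    intro s x hx
    rw [hVm] at hx ⊢
    have := hx.norm.const_mul C
    rw [norm_zero, mul_zero] at this
    exact squeeze_zero_norm' (hbound s x) this
  have hwV : ∀ x ∈ Vm, P w x ∈ Vp := by
    intro x hx
    rw [hVm] at hx
    rw [hVp]
    have h1 := ((P w).continuous.tendsto 0).comp (hx.comp tendsto_neg_atBot_atTop)
    rw [map_zero] at h1
    refine h1.congr fun t => ?_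
    simp only [Function.comp]
    rw [← hPm, ← hPm, hAw]
  have hBd : ∀ x ∈ V0 ⊔ Vm, ∃ K, ∀ᶠ t : ℝ in atTop, ‖P (A t) x‖ ≤ K := by
    intro x hx
    obtain ⟨z, hz, m, hm, rfl⟩ := Submodule.mem_sup.1 hx
    have hm1 := ((hVm m).1 hm).norm
    rw [norm_zero] at hm1
    refine ⟨‖z‖ + 1, ?_⟩
    filter_upwards [hm1.eventually_le_const zero_lt_one] with t ht
    rw [map_add, (hV0 z).1 hz t]
    exact (norm_add_le _ _).trans (by linarith)
  have hAVp : ∀ t, ∀ x ∈ Vp, P (A t) x ∈ Vp := by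
    intro t x hx
    rw [hVp] at hx ⊢
    have h1 := ((P (A t)).continuous.tendsto 0).comp hx
    rw [map_zero] at h1
    refine h1.congr fun s => ?_
    simp only [Function.comp]
    rw [← hPm, ← hPm, ← hAadd, ← hAadd, add_comm]
  have hzero : ∀ p ∈ Vp, (∃ K, ∀ᶠ t : ℝ in atTop, ‖P (A t) p‖ ≤ K) → p = 0 := by
    rintro p hp ⟨K, hK⟩
    let b := Module.finBasis ℝ Vp
    let c : ∀ i, Vp →L[ℝ] ℝ := fun i => LinearMap.toContinuousLinearMap (b.coord i)
    have hsum : ∀ t : ℝ, p = ∑ i, c i ⟨P (A t) p, hAVp t p hp⟩ • P (A (-t)) (b i : V) := by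
      intro t
      have h1 : P (A t) p = ∑ i, c i ⟨P (A t) p, hAVp t p hp⟩ • (b i : V) := by
        have := congrArg (Subtype.val) (b.sum_repr ⟨P (A t) p, hAVp t p hp⟩)
        simp only [Submodule.coe_sum, Submodule.coe_smul] at this
        exact this.symm
      have h2 : p = P (A (-t)) (P (A t) p) := by
        rw [← hPm, ← hAadd, neg_add_cancel, hA0, hP1]
      conv_lhs => rw [h2, h1]
      simp only [map_sum, map_smul]
    have hlim : Tendsto (fun t : ℝ => ∑ i, c i ⟨P (A t) p, hAVp t p hp⟩ • P (A (-t)) (b i : V))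
        atTop (𝓝 (∑ _i : Fin (Module.finrank ℝ Vp), (0 : V))) := by
      refine tendsto_finsetSum _ fun i _ => ?_
      have hb : Tendsto (fun t : ℝ => P (A (-t)) (b i : V)) atTop (𝓝 0) :=
        ((hVp _).1 (b i).2).comp tendsto_neg_atTop_atBot
      have h3 := hb.norm.const_mul (‖c i‖ * K)
      rw [norm_zero, mul_zero] at h3
      refine squeeze_zero_norm' ?_ h3
      filter_upwards [hK] with t ht
      rw [norm_smul]
      exact mul_le_mul_of_nonneg_right ((c i).le_opNorm_of_le ht) (norm_nonneg _)
    rw [Finset.sum_const_zero] at hlim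
    have hconst : Tendsto (fun _ : ℝ => p) atTop (𝓝 0) := hlim.congr fun t => (hsum t).symm
    exact tendsto_nhds_unique tendsto_const_nhds hconst
  intro hq
  replace hq : qp (P ⟨!![1, r; 0, 1], by simp [Matrix.det_fin_two_of]⟩ v) = 0 := hq
  have hmem := (hqp (P ⟨!![1, r; 0, 1], by simp [Matrix.det_fin_two_of]⟩ v)).2
  rw [hq, sub_zero, hu, hPm, hPm] at hmem
  obtain ⟨K, hK⟩ := hBd _ hmem
  have hp0 : P w (P (n r⁻¹) v) = 0 := by
    refine hzero _ (hwV _ (hnVm _ _ hv)) ⟨C * K, ?_⟩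
    filter_upwards [hK, hbound (-r⁻¹) (P (n r⁻¹) (P w (P (n r⁻¹) v)))] with t h1 h2
    rw [← hPm (n (-r⁻¹)), ← hnadd, neg_add_cancel, hn0, hP1] at h2
    exact h2.trans (mul_le_mul_of_nonneg_left h1 hC0)
  rw [← hPm] at hp0
  apply hv0
  rw [← hP1 v, ← inv_mul_cancel (w * n r⁻¹), hPm, hp0, map_zero]
end

section
/- Let ρ : SL(2,ℝ) → GL(V) be a finite-dimensional real representation, with V⁻, V⁰, V⁺ and projections as above. If v ∈ V⁻ + V⁰ and for some r ∈ ℝ also ρ(u_r)v ∈ V⁻ + V⁰ where u_r = [[1,r],[0,1]] with r ≠ 0, then q⁰(ρ(u_r)v) = ρ(E) q⁰(v), where E = [[0,1],[−1,0]]. -/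
namespace SL2Aux

/-- Laurent polynomial functions on the nonzero reals. -/
def RF (f : ℝ → ℝ) : Prop :=
  ∃ (D : ℕ) (p : Polynomial ℝ), ∀ x : ℝ, x ≠ 0 → x ^ D * f x = p.eval x

theorem RF.const (c : ℝ) : RF (fun _ => c) := ⟨0, Polynomial.C c, fun x _ => by simp⟩

theorem RF.id : RF (fun x => x) := ⟨0, Polynomial.X, fun x _ => by simp⟩

theorem RF.inv : RF (fun x => x⁻¹) := ⟨1, 1, fun x hx => by simp [hx]⟩

theorem RF.add {f g : ℝ → ℝ} (hf : RF f) (hg : RF g) : RF (fun x => f x + g x) := by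
  obtain ⟨D, p, hp⟩ := hf
  obtain ⟨D', p', hp'⟩ := hg
  refine ⟨D + D', Polynomial.X ^ D' * p + Polynomial.X ^ D * p', fun x hx => ?_⟩
  simp only [Polynomial.eval_add, Polynomial.eval_mul, Polynomial.eval_pow, Polynomial.eval_X,
    ← hp x hx, ← hp' x hx]
  ring

theorem RF.mul {f g : ℝ → ℝ} (hf : RF f) (hg : RF g) : RF (fun x => f x * g x) := by
  obtain ⟨D, p, hp⟩ := hf
  obtain ⟨D', p', hp'⟩ := hg
  refine ⟨D + D', p * p', fun x hx => ?_⟩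
  simp only [Polynomial.eval_mul, ← hp x hx, ← hp' x hx]
  ring

theorem RF.sub {f g : ℝ → ℝ} (hf : RF f) (hg : RF g) : RF (fun x => f x - g x) := by
  have := hf.add ((RF.const (-1)).mul hg)
  convert this using 2
  ring

theorem RF.sum {ι : Type*} (s : Finset ι) {f : ι → ℝ → ℝ} (hf : ∀ i, RF (f i)) :
    RF (fun x => ∑ i ∈ s, f i x) := by
  classical
  induction s using Finset.induction_on with
  | empty => simpa using RF.const 0
  | insert a s ha ih =>
    simp only [Finset.sum_insert ha]
    exact (hf a).add ih

theorem RF.comp {f : ℝ → ℝ} (hf : RF f) (p : Polynomial ℝ) : RF (fun x => p.eval (f x)) := by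
  induction p using Polynomial.induction_on' with
  | add p q hp hq => simpa using hp.add hq
  | monomial n a =>
    simp only [Polynomial.eval_monomial]
    refine (RF.const a).mul ?_
    induction n with
    | zero => simpa using RF.const 1
    | succ n ih => simpa [pow_succ] using ih.mul hf

theorem RF.eq_zero {f : ℝ → ℝ} (hf : RF f) (h : ∀ n : ℕ, 0 < n → f n = 0) {x : ℝ} (hx : x ≠ 0) :
    f x = 0 := by
  obtain ⟨D, p, hp⟩ := hf
  have hp0 : p = 0 := by
    apply Polynomial.eq_zero_of_infinite_isRoot
    have : Set.range (fun n : ℕ => ((n + 1 : ℕ) : ℝ)) ⊆ {x | p.IsRoot x} := by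
      rintro _ ⟨n, rfl⟩
      have h1 : ((n + 1 : ℕ) : ℝ) ≠ 0 := by positivity
      have := hp _ h1
      rw [h _ (Nat.succ_pos n), mul_zero] at this
      exact this.symm
    refine (Set.infinite_range_of_injective ?_).mono this
    intro a b hab
    simpa using hab
  have := hp x hx
  rw [hp0, Polynomial.eval_zero] at this
  exact (mul_eq_zero.1 this).resolve_left (pow_ne_zero _ hx)

section alg
variable {S : Type*} [Ring S] [Algebra ℝ S]

noncomputable def bp (k : ℕ) : Polynomial ℝ := Polynomial.C ((k.factorial : ℝ)⁻¹) * descPochhammer ℝ k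

theorem bp_eval (k n : ℕ) : (bp k).eval (n : ℝ) = n.choose k := by
  rw [bp, Polynomial.eval_mul, Polynomial.eval_C, descPochhammer_eval_eq_descFactorial,
    Nat.descFactorial_eq_factorial_mul_choose]
  push_cast
  field_simp

/-- Real powers of a unipotent element. -/
noncomputable def B (M : S) (d : ℕ) (x : ℝ) : S :=
  ∑ k ∈ Finset.range d, (bp k).eval x • (M - 1) ^ k

theorem B_nat (M : S) (d : ℕ) (hM : (M - 1) ^ d = 0) (n : ℕ) : B M d n = M ^ n := by
  have h1 : M ^ n = ∑ k ∈ Finset.range (n + 1), (n.choose k : ℝ) • (M - 1) ^ k := by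
    have := (Commute.one_right (M - 1)).add_pow n
    rw [sub_add_cancel] at this
    rw [this]
    refine Finset.sum_congr rfl fun k _ => ?_
    rw [one_pow, mul_one, Nat.cast_smul_eq_nsmul, nsmul_eq_mul, Nat.cast_comm]
  have h2 : ∑ k ∈ Finset.range (n + 1), (n.choose k : ℝ) • (M - 1) ^ k =
      ∑ k ∈ Finset.range (n + 1 + d), (n.choose k : ℝ) • (M - 1) ^ k := by
    refine Finset.sum_subset (by intro k; simp; omega) fun k _ hk => ?_
    rw [Nat.choose_eq_zero_of_lt (by simpa using hk)]
    simp
  have h3 : B M d n = ∑ k ∈ Finset.range (n + 1 + d), (n.choose k : ℝ) • (M - 1) ^ k := by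
    simp only [B, bp_eval]
    refine Finset.sum_subset (by intro k; simp; omega) fun k _ hk => ?_
    have : d ≤ k := by simpa using hk
    rw [pow_eq_zero_of_le this hM, smul_zero]
  rw [h1, h2, h3]

theorem RF.B1 {f : ℝ → ℝ} (hf : RF f) (M C : S) (d : ℕ) (ψ : S →ₗ[ℝ] ℝ) :
    RF (fun x => ψ (C * B M d (f x))) := by
  simp only [B, Finset.mul_sum, map_sum, mul_smul_comm, map_smul, smul_eq_mul]
  exact RF.sum _ fun k => (hf.comp _).mul (RF.const _)

theorem RF.B2 {f g : ℝ → ℝ} (hf : RF f) (hg : RF g) (M M' : S) (d d' : ℕ) (ψ : S →ₗ[ℝ] ℝ) :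
    RF (fun x => ψ (B M d (f x) * B M' d' (g x))) := by
  have : ∀ x, ψ (B M d (f x) * B M' d' (g x)) = ∑ k ∈ Finset.range d,
      (bp k).eval (f x) * ψ ((M - 1) ^ k * B M' d' (g x)) := by
    intro x
    conv_lhs => rw [B]
    simp only [Finset.sum_mul, map_sum, smul_mul_assoc, map_smul, smul_eq_mul]
  simp only [this]
  exact RF.sum _ fun k => (hf.comp _).mul (RF.B1 hg _ _ _ _)

theorem sep {X Y : S} (h : ∀ ψ : S →ₗ[ℝ] ℝ, ψ X - ψ Y = 0) : X = Y := by
  rw [← sub_eq_zero, ← Module.forall_dual_apply_eq_zero_iff ℝ]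
  intro ψ
  rw [map_sub]; exact h ψ

variable (L : ℝ → S) (hL0 : L 0 = 1) (hL : ∀ a b, L (a + b) = L a * L b) (d : ℕ)
  (hd : ∀ s, (L s - 1) ^ d = 0)
include hL0 hL

theorem L_pow (s : ℝ) (n : ℕ) : L s ^ n = L (n * s) := by
  induction n with
  | zero => simp [hL0]
  | succ n ih => rw [pow_succ, ih, ← hL]; congr 1; push_cast; ring

include hd

theorem B_L_nat (n : ℕ) : B (L 1) d n = L n := by
  rw [B_nat _ _ (hd 1), L_pow L hL0 hL]; simp

theorem B_L_inv (m : ℕ) (hm : 0 < m) : B (L 1) d ((m : ℝ)⁻¹) = L ((m : ℝ)⁻¹) := by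
  have hm' : (m : ℝ) ≠ 0 := by positivity
  have key : ∀ x : ℝ, x ≠ 0 → B (L 1) d x = B (L (m : ℝ)⁻¹) d (m * x) := by
    intro x hx
    apply sep
    intro ψ
    have h1 := (RF.B1 RF.id (L 1) 1 d ψ).sub
      (RF.B1 ((RF.const m).mul RF.id) (L (m : ℝ)⁻¹) 1 d ψ)
    have := h1.eq_zero (fun n _ => ?_) hx
    · simpa using this
    · simp only [one_mul]
      rw [B_L_nat L hL0 hL d hd, ← Nat.cast_mul, B_nat _ _ (hd _), L_pow L hL0 hL, sub_eq_zero]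
      congr 2
      push_cast
      field_simp
  rw [key _ (inv_ne_zero hm'), mul_inv_cancel₀ hm']
  have := B_nat _ _ (hd (m : ℝ)⁻¹) 1
  simpa using this

theorem B_L_neg (m : ℕ) (hm : 0 < m) : B (L 1) d (-(m : ℝ)) = L (-(m : ℝ)) := by
  have hm' : (m : ℝ) ≠ 0 := by positivity
  have key : ∀ x : ℝ, x ≠ 0 → B (L 1) d (x + m) = L m * B (L 1) d x := by
    intro x hx
    apply sep
    intro ψ
    have h1 := (RF.B1 (RF.id.add (RF.const m)) (L 1) 1 d ψ).sub (RF.B1 RF.id (L 1) (L m) d ψ)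
    have := h1.eq_zero (fun n _ => ?_) hx
    · simpa using this
    · simp only [one_mul]
      rw [B_L_nat L hL0 hL d hd, ← Nat.cast_add, B_L_nat L hL0 hL d hd, ← hL, sub_eq_zero]
      congr 2
      push_cast
      ring
  have h := key _ (neg_ne_zero.2 hm')
  have h0 := B_L_nat L hL0 hL d hd 0
  rw [Nat.cast_zero, hL0] at h0
  rw [neg_add_cancel, h0] at h
  have : L (-(m : ℝ)) * 1 = L (-(m : ℝ)) * (L m * B (L 1) d (-(m : ℝ))) := by rw [← h]
  rw [← mul_assoc, ← hL, neg_add_cancel, hL0, one_mul, mul_one] at this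
  exact this.symm

end alg
end SL2Aux

namespace SL2Aux
open Filter Topology

variable {V : Type*} [NormedAddCommGroup V] [NormedSpace ℝ V] [FiniteDimensional ℝ V]

theorem bz (W : Submodule ℝ V) (F : ℝ → V →L[ℝ] V) (l : Filter ℝ)
    (hF : ∀ x ∈ W, Tendsto (fun t => F t x) l (𝓝 0)) (f : ℝ → V) (hfW : ∀ t, f t ∈ W)
    (C : ℝ) (hC : ∀ᶠ t in l, ‖f t‖ ≤ C) : Tendsto (fun t => F t (f t)) l (𝓝 0) := by
  let b := Module.finBasis ℝ W
  have h1 : ∀ t, F t (f t) = ∑ i, (b.coord i ⟨f t, hfW t⟩) • F t (b i : V) := by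
    intro t
    have := b.sum_repr ⟨f t, hfW t⟩
    have h2 := congrArg (fun w : W => F t (w : V)) this
    simp only [AddSubmonoidClass.coe_finsetSum, map_sum, Submodule.coe_smul, map_smul] at h2
    rw [← h2]
    rfl
  simp only [h1]
  rw [← Finset.sum_const_zero (s := (Finset.univ : Finset (Fin (Module.finrank ℝ W))))]
  refine tendsto_finsetSum _ fun i _ => ?_
  let c := LinearMap.toContinuousLinearMap (b.coord i)
  have hb : ∀ᶠ t in l, ‖b.coord i ⟨f t, hfW t⟩‖ ≤ ‖c‖ * C := by
    filter_upwards [hC] with t ht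
    calc ‖b.coord i ⟨f t, hfW t⟩‖ = ‖c ⟨f t, hfW t⟩‖ := rfl
      _ ≤ ‖c‖ * ‖(⟨f t, hfW t⟩ : W)‖ := c.le_opNorm _
      _ ≤ ‖c‖ * C := by
        exact mul_le_mul_of_nonneg_left (by exact ht) (norm_nonneg c)
  have h0 := hF (b i) (b i).2
  rw [tendsto_zero_iff_norm_tendsto_zero] at h0 ⊢
  have h3 := h0.const_mul (‖c‖ * C)
  rw [mul_zero] at h3
  refine squeeze_zero' (Eventually.of_forall fun t => norm_nonneg _) ?_ h3
  filter_upwards [hb] with t ht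
  rw [norm_smul]
  exact mul_le_mul_of_nonneg_right ht (norm_nonneg _)

theorem expand_zero (T : ℝ → V →L[ℝ] V) (hT0 : T 0 = 1) (hT : ∀ a b, T (a + b) = T a * T b)
    (P : Submodule ℝ V) (hP : ∀ v, v ∈ P ↔ Tendsto (fun t => T t v) atBot (𝓝 0))
    (x : V) (hx : x ∈ P) (C : ℝ) (hC : ∀ᶠ t in atTop, ‖T t x‖ ≤ C) : x = 0 := by
  have hmem : ∀ t, T t x ∈ P := by
    intro t
    rw [hP] at hx ⊢
    have h1 : Tendsto (fun s => T t (T s x)) atBot (𝓝 (T t 0)) :=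
      ((T t).continuous.tendsto 0).comp hx
    rw [map_zero] at h1
    refine h1.congr fun s => ?_
    change (T t * T s) x = (T s * T t) x
    rw [← hT, ← hT, add_comm]
  have h2 := bz P (fun t => T (-t)) atTop
    (fun y hy => ((hP y).1 hy).comp tendsto_neg_atTop_atBot) (fun t => T t x) hmem C hC
  have h3 : ∀ t, T (-t) (T t x) = x := by
    intro t
    change (T (-t) * T t) x = x
    rw [← hT, neg_add_cancel, hT0]; rfl
  simp only [h3] at h2
  exact tendsto_nhds_unique tendsto_const_nhds h2

theorem bound_bot (T : ℝ → V →L[ℝ] V) (hT : ∀ a b, T (a + b) = T a * T b)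
    (x : V) (hx : Tendsto (fun t => T t x) atBot (𝓝 0)) :
    ∃ C, ∀ t ≤ 1, ‖T t x‖ ≤ C := by
  have h1 : ∀ᶠ t in atBot, ‖T t x‖ < 1 := by
    have := (tendsto_zero_iff_norm_tendsto_zero.1 hx)
    exact this.eventually (gt_mem_nhds one_pos)
  obtain ⟨a, ha⟩ := eventually_atBot.1 h1
  refine ⟨‖T (1 - a)‖, fun t ht => ?_⟩
  have h2 : T t x = T (1 - a) (T (t - (1 - a)) x) := by
    change _ = (T (1 - a) * T (t - (1 - a))) x
    rw [← hT]; congr 2; ring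
  rw [h2]
  refine ((T (1 - a)).le_opNorm _).trans ?_
  have := ha (t - (1 - a)) (by linarith)
  exact mul_le_of_le_one_right (norm_nonneg _) this.le

theorem bound_T (T : ℝ → V →L[ℝ] V) (hT : ∀ a b, T (a + b) = T a * T b)
    (hdec : ∀ v, ∃ z p m, v = z + p + m ∧ (∀ t, T t z = z) ∧
      Tendsto (fun t => T t p) atBot (𝓝 0) ∧ Tendsto (fun t => T t m) atTop (𝓝 0)) :
    ∃ C, ∀ t : ℝ, -1 ≤ t → t ≤ 1 → ‖T t‖ ≤ C := by
  have := banach_steinhaus (g := fun t : Set.Icc (-1 : ℝ) 1 => T t) (by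
    intro v
    obtain ⟨z, p, m, rfl, hz, hp, hm⟩ := hdec v
    obtain ⟨C1, h1⟩ := bound_bot T hT p hp
    obtain ⟨C2, h2⟩ := bound_bot (fun t => T (-t))
      (fun a b => by rw [neg_add, hT]) m (hm.comp tendsto_neg_atBot_atTop)
    refine ⟨‖z‖ + C1 + C2, fun t => ?_⟩
    rw [map_add, map_add, hz]
    have := h2 (-t) (by linarith [t.2.1])
    rw [neg_neg] at this
    exact (norm_add₃_le).trans (by linarith [h1 t t.2.2]))
  obtain ⟨C, hC⟩ := this
  exact ⟨C, fun t h1 h2 => hC ⟨t, h1, h2⟩⟩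

section L
variable (T : ℝ → V →L[ℝ] V) (hT0 : T 0 = 1) (hT : ∀ a b, T (a + b) = T a * T b)
  (L : ℝ → V →L[ℝ] V) (hL0 : L 0 = 1) (hL : ∀ a b, L (a + b) = L a * L b)
  (hTL : ∀ t s, T t * L s = L (Real.exp (-2 * t) * s) * T t)
include hT0 hT hL hTL

omit [FiniteDimensional ℝ V] hL in
theorem conj_L (s : ℝ) (x : ℝ) (hx : 0 < x) :
    L (x * s) = T (-(Real.log x / 2)) * L s * T (Real.log x / 2) := by
  rw [hTL, mul_assoc, ← hT]
  rw [neg_add_cancel, hT0, mul_one]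
  congr 2
  rw [show -2 * -(Real.log x / 2) = Real.log x by ring, Real.exp_log hx]

omit [FiniteDimensional ℝ V] in
theorem bound_L (hb : ∃ C, ∀ t : ℝ, -1 ≤ t → t ≤ 1 → ‖T t‖ ≤ C) :
    ∃ C, ∀ s : ℝ, -1 ≤ s → s ≤ 1 → ‖L s‖ ≤ C := by
  obtain ⟨C, hC⟩ := hb
  have hC0 : 0 ≤ C := (norm_nonneg _).trans (hC 0 (by norm_num) (by norm_num))
  refine ⟨C * ‖L 1‖ * C * ‖L (-2)‖, fun s h1 h2 => ?_⟩
  have h3 : L s = L (s + 2) * L (-2) := by rw [← hL]; congr 1; ring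
  have h4 := conj_L T hT0 hT L hTL 1 (s + 2) (by linarith)
  rw [mul_one] at h4
  have l1 : 0 ≤ Real.log (s + 2) := Real.log_nonneg (by linarith)
  have l2 : Real.log (s + 2) ≤ 2 := by
    have := Real.log_le_sub_one_of_pos (show 0 < s + 2 by linarith)
    linarith
  have a1 := hC (-(Real.log (s + 2) / 2)) (by linarith) (by linarith)
  have a2 := hC (Real.log (s + 2) / 2) (by linarith) (by linarith)
  rw [h3, h4]
  calc _ ≤ ‖T (-(Real.log (s + 2) / 2))‖ * ‖L 1‖ * ‖T (Real.log (s + 2) / 2)‖ * ‖L (-2)‖ := by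
        refine (norm_mul_le _ _).trans ?_
        gcongr
        refine (norm_mul_le _ _).trans ?_
        gcongr
        exact norm_mul_le _ _
    _ ≤ _ := by gcongr

include hL0

theorem unip (hb : ∃ C, ∀ s : ℝ, -1 ≤ s → s ≤ 1 → ‖L s‖ ≤ C) (s : ℝ) :
    (L s - 1) ^ (Module.finrank ℝ V + 1) = 0 := by
  -- determinant is constant along positive s
  have hdet : ∀ x s : ℝ, 0 < s → (x • (1 : V →L[ℝ] V) - L s).det =
      (x • (1 : V →L[ℝ] V) - L 1).det := by
    intro x s hs
    have h1 := conj_L T hT0 hT L hTL 1 s hs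
    rw [mul_one] at h1
    have hTT : T (-(Real.log s / 2)) * T (Real.log s / 2) = 1 := by
      rw [← hT, neg_add_cancel, hT0]
    have h2 : x • (1 : V →L[ℝ] V) - L s =
        T (-(Real.log s / 2)) * (x • (1 : V →L[ℝ] V) - L 1) * T (Real.log s / 2) := by
      rw [h1, mul_sub, sub_mul, mul_smul_comm, smul_mul_assoc, mul_one, hTT]
    have hm : ∀ X Y : V →L[ℝ] V, (X * Y).det = X.det * Y.det := by
      intro X Y
      exact LinearMap.det_comp _ _
    have hone : (1 : V →L[ℝ] V).det = 1 := LinearMap.det_id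
    rw [h2, hm, hm]
    have h3 : (T (-(Real.log s / 2))).det * (T (Real.log s / 2)).det = 1 := by
      rw [← hm, hTT, hone]
    linear_combination (x • (1 : V →L[ℝ] V) - L 1).det * h3
  -- a sequence of elements converging to one
  have hseq : ∃ σ : ℕ → ℝ, (∀ k, 0 < σ k) ∧ Tendsto (fun k => L (σ k)) atTop (𝓝 1) := by
    obtain ⟨C, hC⟩ := hb
    let e : ℕ → ℝ := fun k => 1 / ((k : ℝ) + 1)
    have he : ∀ k, 0 < e k ∧ e k ≤ 1 := by
      intro k
      refine ⟨by positivity, ?_⟩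
      rw [div_le_one (by positivity)]
      have : (0 : ℝ) ≤ k := by positivity
      linarith
    have : ProperSpace ((V →L[ℝ] V) × (V →L[ℝ] V)) := FiniteDimensional.proper ℝ _
    obtain ⟨⟨a, b⟩, -, φ, hφ, hlim⟩ := tendsto_subseq_of_bounded
      (Metric.isBounded_closedBall (x := (0 : (V →L[ℝ] V) × (V →L[ℝ] V))) (r := C))
      (x := fun k => (L (e k), L (-e k))) (by
        intro k
        rw [mem_closedBall_zero_iff, Prod.norm_def]
        exact max_le (hC _ (by linarith [(he k).1]) (he k).2)
          (hC _ (by linarith [(he k).2]) (by linarith [(he k).1])))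
    have ha : Tendsto (fun k => L (e (φ k))) atTop (𝓝 a) :=
      (continuous_fst.tendsto _).comp hlim
    have hb : Tendsto (fun k => L (-e (φ k))) atTop (𝓝 b) :=
      (continuous_snd.tendsto _).comp hlim
    have hab : a * b = 1 := by
      refine tendsto_nhds_unique (ha.mul hb) ?_
      simp only [← hL, add_neg_cancel, hL0]
      exact tendsto_const_nhds
    refine ⟨fun k => e (φ k) + -e (φ (k + 1)), fun k => ?_, ?_⟩
    · have h1 : φ k < φ (k + 1) := hφ (Nat.lt_succ_self k)
      have h2 : (φ k : ℝ) < φ (k + 1) := by exact_mod_cast h1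
      have h3 : e (φ (k + 1)) < e (φ k) := by
        apply one_div_lt_one_div_of_lt
        · positivity
        · linarith
      linarith
    · simp only [hL]
      rw [← hab]
      exact ha.mul (hb.comp (tendsto_add_atTop_nat 1))
  obtain ⟨σ, hσ, hσ1⟩ := hseq
  have hdet1 : ∀ x : ℝ, (x • (1 : V →L[ℝ] V) - L 1).det = (x - 1) ^ Module.finrank ℝ V := by
    intro x
    have h1 : Tendsto (fun k => (x • (1 : V →L[ℝ] V) - L (σ k)).det) atTop
        (𝓝 ((x • (1 : V →L[ℝ] V) - 1).det)) :=
      (ContinuousLinearMap.continuous_det.tendsto _).comp (tendsto_const_nhds.sub hσ1)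
    simp only [hdet x _ (hσ _)] at h1
    have h2 := tendsto_nhds_unique tendsto_const_nhds h1
    rw [h2]
    have h3 : ((x • (1 : V →L[ℝ] V) - 1 : V →L[ℝ] V) : V →ₗ[ℝ] V) = (x - 1) • LinearMap.id := by
      ext v; simp [sub_smul]
    rw [ContinuousLinearMap.det, h3, LinearMap.det_smul, LinearMap.det_id, mul_one]
  have hpos : ∀ s : ℝ, 0 < s → (L s - 1) ^ (Module.finrank ℝ V + 1) = 0 := by
    intro s hs
    have h1 : (L s : V →ₗ[ℝ] V).charpoly =
        (Polynomial.X - Polynomial.C 1) ^ Module.finrank ℝ V := by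
      apply Polynomial.funext
      intro x
      rw [LinearMap.eval_charpoly]
      simp only [Polynomial.eval_pow, Polynomial.eval_sub, Polynomial.eval_X, Polynomial.eval_C]
      rw [← hdet1 x, ← hdet x s hs]
      rw [ContinuousLinearMap.det]
      congr 1
    have h2 := LinearMap.aeval_self_charpoly (L s : V →ₗ[ℝ] V)
    rw [h1] at h2
    simp only [map_pow, map_sub, Polynomial.aeval_X, Polynomial.aeval_C, map_one] at h2
    have h3 : (L s - 1) ^ (Module.finrank ℝ V) = 0 := by
      apply ContinuousLinearMap.coe_injective
      have : ∀ n, (((L s - 1) ^ n : V →L[ℝ] V) : V →ₗ[ℝ] V) = ((L s : V →ₗ[ℝ] V) - 1) ^ n := by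
        intro n
        induction n with
        | zero => rfl
        | succ n ih => rw [pow_succ, pow_succ, ← ih]; rfl
      rw [this, h2]; rfl
    rw [pow_succ, h3, zero_mul]
  rcases lt_trichotomy s 0 with h | h | h
  · have h1 := hpos (-s) (by linarith)
    have h2 : L s - 1 = (-L s) * (L (-s) - 1) := by
      rw [mul_sub, neg_mul, ← hL, add_neg_cancel, hL0]; simp; abel
    have h3 : Commute (-L s) (L (-s) - 1) := by
      apply Commute.sub_right _ (Commute.one_right _)
      apply Commute.neg_left
      change L s * L (-s) = L (-s) * L s
      rw [← hL, ← hL, add_comm]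
    rw [h2, h3.mul_pow, h1, mul_zero]
  · rw [h, hL0, sub_self, zero_pow (Nat.succ_ne_zero _)]
  · exact hpos s h
end L
end SL2Aux

namespace SL2Aux
open Filter Topology

/-- The group `SL(2,ℝ)`. -/
abbrev G := Matrix.SpecialLinearGroup (Fin 2) ℝ

def lm (s : ℝ) : G := ⟨!![1, 0; s, 1], by simp [Matrix.det_fin_two_of]⟩
def um (r : ℝ) : G := ⟨!![1, r; 0, 1], by simp [Matrix.det_fin_two_of]⟩
def em : G := ⟨!![0, 1; -1, 0], by simp [Matrix.det_fin_two_of]⟩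
def nm : G := ⟨!![-1, 0; 0, -1], by simp [Matrix.det_fin_two_of]⟩

theorem lm_coe (s : ℝ) : (lm s : Matrix (Fin 2) (Fin 2) ℝ) = !![1, 0; s, 1] := rfl
theorem um_coe (s : ℝ) : (um s : Matrix (Fin 2) (Fin 2) ℝ) = !![1, s; 0, 1] := rfl
theorem em_coe : (em : Matrix (Fin 2) (Fin 2) ℝ) = !![0, 1; -1, 0] := rfl
theorem nm_coe : (nm : Matrix (Fin 2) (Fin 2) ℝ) = !![-1, 0; 0, -1] := rfl

theorem lm_zero : lm 0 = 1 := by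
  apply Subtype.ext; simp [lm_coe, Matrix.one_fin_two]

theorem um_zero : um 0 = 1 := by
  apply Subtype.ext; simp [um_coe, Matrix.one_fin_two]

theorem lm_add (a b : ℝ) : lm (a + b) = lm a * lm b := by
  apply Subtype.ext; simp [lm_coe]

theorem um_add (a b : ℝ) : um (a + b) = um a * um b := by
  apply Subtype.ext; simp [um_coe, add_comm]

theorem um_em (r : ℝ) : um r * em = em * lm (-r) := by
  apply Subtype.ext; simp [um_coe, lm_coe, em_coe]

theorem em_inv : em * (nm * em) = 1 := by
  apply Subtype.ext; simp [em_coe, nm_coe, Matrix.one_fin_two]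

theorem um_neg_two : um (-2) * lm 1 = lm (-1) * um 2 * nm := by
  apply Subtype.ext; simp [um_coe, lm_coe, nm_coe]; norm_num

section A
variable (A : ℝ → G)
    (hA : ∀ t : ℝ, (A t : Matrix (Fin 2) (Fin 2) ℝ) = !![Real.exp t, 0; 0, Real.exp (-t)])
include hA

theorem A_zero : A 0 = 1 := by
  apply Subtype.ext; simp [hA, Matrix.one_fin_two]

theorem A_add (a b : ℝ) : A (a + b) = A a * A b := by
  apply Subtype.ext; simp [hA, ← Real.exp_add, add_comm]

theorem A_lm (t s : ℝ) : A t * lm s = lm (Real.exp (-2 * t) * s) * A t := by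
  apply Subtype.ext
  have : Real.exp (-t) = Real.exp (-2 * t) * Real.exp t := by rw [← Real.exp_add]; congr 1; ring
  simp [hA, lm_coe, this]; ring

theorem A_em (t : ℝ) : A t * em = em * A (-t) := by
  apply Subtype.ext; simp [hA, em_coe]

theorem A_nm (t : ℝ) : A t * nm = nm * A t := by
  apply Subtype.ext; simp [hA, nm_coe]

theorem um_lm (c : ℝ) (hc : 0 < c) :
    um (c - 1) * lm 1 = lm c⁻¹ * um (c * (c - 1)) * A (Real.log c) := by
  apply Subtype.ext; simp [hA, um_coe, lm_coe, Real.exp_neg, Real.exp_log hc]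
  field_simp; simp

theorem um_pos (r : ℝ) (hr : 0 < r) :
    um r = lm r⁻¹ * (A (Real.log r) * em) * lm r⁻¹ := by
  apply Subtype.ext; simp [hA, um_coe, lm_coe, em_coe, Real.exp_neg, Real.exp_log hr, hr.ne']

theorem um_negr (r : ℝ) (hr : r < 0) :
    um r = lm r⁻¹ * (A (Real.log (-r)) * nm * em) * lm r⁻¹ := by
  apply Subtype.ext
  simp [hA, um_coe, lm_coe, em_coe, nm_coe, Real.exp_neg, Real.exp_log_of_neg hr, hr.ne]

end A

variable {V : Type*} [NormedAddCommGroup V] [NormedSpace ℝ V] [FiniteDimensional ℝ V]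

theorem main_aux (R : G →* (V →L[ℝ] V)) (A : ℝ → G)
    (hA : ∀ t : ℝ, (A t : Matrix (Fin 2) (Fin 2) ℝ) = !![Real.exp t, 0; 0, Real.exp (-t)])
    (Vp V0 Vm : Submodule ℝ V)
    (hVp : ∀ v : V, v ∈ Vp ↔ Tendsto (fun t : ℝ => R (A t) v) atBot (𝓝 0))
    (hV0 : ∀ v : V, v ∈ V0 ↔ ∀ t : ℝ, R (A t) v = v)
    (hVm : ∀ v : V, v ∈ Vm ↔ Tendsto (fun t : ℝ => R (A t) v) atTop (𝓝 0))
    (q0 : V →ₗ[ℝ] V)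
    (hq0 : ∀ v : V, q0 v ∈ V0 ∧ v - q0 v ∈ Vp ⊔ Vm)
    (v : V) (hv : v ∈ Vm ⊔ V0) (r : ℝ) (hr : r ≠ 0) (hv' : R (um r) v ∈ Vm ⊔ V0) :
    q0 (R (um r) v) = R em (q0 v) := by
  have Rm : ∀ g h : G, ∀ x, R (g * h) x = R g (R h x) := fun g h x => by rw [map_mul]; rfl
  have R1 : ∀ x, R 1 x = x := fun x => by rw [map_one]; rfl
  let T : ℝ → V →L[ℝ] V := fun t => R (A t)
  let L : ℝ → V →L[ℝ] V := fun s => R (lm s)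
  let U : ℝ → V →L[ℝ] V := fun s => R (um s)
  have hT0 : T 0 = 1 := by simp only [T, A_zero A hA, map_one]
  have hT : ∀ a b, T (a + b) = T a * T b := fun a b => by simp only [T, A_add A hA, map_mul]
  have hL0 : L 0 = 1 := by simp only [L, lm_zero, map_one]
  have hL : ∀ a b, L (a + b) = L a * L b := fun a b => by simp only [L, lm_add, map_mul]
  have hU0 : U 0 = 1 := by simp only [U, um_zero, map_one]
  have hU : ∀ a b, U (a + b) = U a * U b := fun a b => by simp only [U, um_add, map_mul]
  have hTL : ∀ t s, T t * L s = L (Real.exp (-2 * t) * s) * T t := fun t s => by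
    simp only [T, L, ← map_mul, A_lm A hA]
  have hdec : ∀ v, ∃ p ∈ Vp, ∃ m ∈ Vm, v = q0 v + p + m := by
    intro v
    obtain ⟨p, hp, m, hm, h⟩ := Submodule.mem_sup.1 (hq0 v).2
    exact ⟨p, hp, m, hm, by rw [add_assoc, h]; abel⟩
  have hbT := bound_T T hT (fun v => by
    obtain ⟨p, hp, m, hm, h⟩ := hdec v
    exact ⟨q0 v, p, m, h, (hV0 _).1 (hq0 v).1, (hVp p).1 hp, (hVm m).1 hm⟩)
  have hbL := bound_L T hT0 hT L hL hTL hbT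
  have hdL := unip T hT0 hT L hL0 hL hTL hbL
  set d := Module.finrank ℝ V + 1 with hd_def
  have hdU : ∀ s, (U s - 1) ^ d = 0 := by
    intro s
    have hEE : R em * R (nm * em) = 1 := by rw [← map_mul, em_inv, map_one]
    have hEE' : R (nm * em) * R em = 1 := by
      rw [← map_mul, mul_eq_one_comm.1 em_inv, map_one]
    have h0 : SemiconjBy (R em) (L (-s)) (U s) := by
      change R em * L (-s) = U s * R em
      simp only [U, L, ← map_mul, um_em]
    have h1 : ∀ n, (U s - 1) ^ n * R em = R em * (L (-s) - 1) ^ n := fun n =>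
      ((h0.sub_right (SemiconjBy.one_right _)).pow_right n).eq.symm
    have h2 := h1 d
    rw [hdL, mul_zero] at h2
    calc (U s - 1) ^ d = (U s - 1) ^ d * R em * R (nm * em) := by rw [mul_assoc, hEE, mul_one]
      _ = 0 := by rw [h2, zero_mul]
  -- the central element acts trivially on `V0`
  have hneg : ∀ w ∈ V0, R nm w = w := by
    intro w hw
    have key : (B (L 1) d (-1)⁻¹ * B (U 1) d (-1 * (-1 - 1))) w =
        (B (U 1) d (-1 - 1) * B (L 1) d 1) w := by
      rw [← sub_eq_zero, ← Module.forall_dual_apply_eq_zero_iff ℝ]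
      intro φ
      let ψ : (V →L[ℝ] V) →ₗ[ℝ] ℝ :=
        { toFun := fun X => φ (X w)
          map_add' := fun X Y => by simp
          map_smul' := fun a X => by simp }
      have h1 := (RF.B2 RF.inv (RF.id.mul (RF.id.sub (RF.const 1))) (L 1) (U 1) d d ψ).sub
        (RF.B2 (RF.id.sub (RF.const 1)) (RF.const 1) (U 1) (L 1) d d ψ)
      have h2 := h1.eq_zero (fun n hn => ?_) (show (-1 : ℝ) ≠ 0 by norm_num)
      · rw [map_sub]; exact h2
      · obtain ⟨m, rfl⟩ : ∃ m, n = m + 1 := ⟨n - 1, by omega⟩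
        have e1 : (((m + 1 : ℕ) : ℝ) - 1) = (m : ℝ) := by push_cast; ring
        have e2 := B_L_nat L hL0 hL d hdL 1
        rw [Nat.cast_one] at e2
        have e3 := um_lm A hA ((m + 1 : ℕ) : ℝ) (by positivity)
        rw [e1] at e3 ⊢
        rw [← Nat.cast_mul] at e3 ⊢
        rw [B_L_nat U hU0 hU d hdU, B_L_nat U hU0 hU d hdU, e2, B_L_inv L hL0 hL d hdL _ hn,
          sub_eq_zero]
        change φ ((R (lm _) * R (um _)) w) = φ ((R (um _) * R (lm _)) w)
        rw [← map_mul, ← map_mul, e3, Rm _ (A _), (hV0 w).1 hw]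
    have e1 := B_L_neg L hL0 hL d hdL 1 one_pos
    have e2 := B_L_nat U hU0 hU d hdU 2
    have e3 := B_L_neg U hU0 hU d hdU 2 two_pos
    have e4 := B_L_nat L hL0 hL d hdL 1
    norm_num at key e1 e2 e3 e4
    rw [e1, e2, e3, e4] at key
    change (R (lm (-1)) * R (um 2)) w = (R (um (-2)) * R (lm 1)) w at key
    rw [← map_mul, ← map_mul, um_neg_two, Rm (lm (-1) * um 2)] at key
    have h5 := congrArg (R (lm (-1) * um 2)⁻¹) key
    rw [← Rm, ← Rm, inv_mul_cancel, R1, R1] at h5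
    exact h5.symm
  -- vectors of `Vp` with bounded forward orbit vanish
  have hK : ∀ x ∈ Vp, ∀ C, (∀ᶠ t in atTop, ‖R (A t) x‖ ≤ C) → x = 0 := fun x hx C hC =>
    expand_zero T hT0 hT Vp hVp x hx C hC
  have hK' : ∀ x ∈ Vp, ∀ y, Tendsto (fun t => R (A t) x) atTop (𝓝 y) → x = 0 := by
    intro x hx y hy
    have h1 := hy.norm
    exact hK x hx (‖y‖ + 1) ((h1.eventually (gt_mem_nhds (lt_add_one _))).mono fun t ht => ht.le)
  have h0m : ∀ z ∈ V0, z ∈ Vm → z = 0 := by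
    intro z hz hm
    rw [hVm] at hm
    simp only [(hV0 z).1 hz] at hm
    exact tendsto_nhds_unique tendsto_const_nhds hm
  have hpW : ∀ p ∈ Vp, p ∈ Vm ⊔ V0 → p = 0 := by
    intro p hp h
    obtain ⟨m, hm, z, hz, rfl⟩ := Submodule.mem_sup.1 h
    refine hK' _ hp z ?_
    simp only [map_add, (hV0 z).1 hz]
    simpa using ((hVm m).1 hm).add_const z
  have hq : ∀ z ∈ V0, ∀ m ∈ Vm, q0 (z + m) = z := by
    intro z hz m hm
    obtain ⟨p, hp, m', hm', h⟩ := hdec (z + m)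
    have hp0 : p = 0 := hpW p hp (Submodule.mem_sup.2
      ⟨m - m', sub_mem hm hm', z - q0 (z + m), sub_mem hz (hq0 _).1, by
        have : p = z + m - q0 (z + m) - m' := by
          conv_rhs => enter [1, 1]; rw [h]
          abel
        rw [this]; abel⟩)
    rw [hp0, add_zero] at h
    have h2 : z - q0 (z + m) = m' - m := by
      have : z = q0 (z + m) + m' - m := by rw [← h]; abel
      conv_lhs => enter [1]; rw [this]
      abel
    have := h0m _ (sub_mem hz (hq0 (z + m)).1) (by rw [h2]; exact sub_mem hm' hm)
    exact (sub_eq_zero.1 this).symm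
  -- elements of W
  have hW : ∀ x ∈ Vm ⊔ V0, x - q0 x ∈ Vm := by
    intro x hx
    obtain ⟨m, hm, z, hz, rfl⟩ := Submodule.mem_sup.1 hx
    rw [add_comm m z, hq z hz m hm]; simpa using hm
  -- L on Vm
  have hs1 : ∀ s : ℝ, ∀ᶠ t : ℝ in atTop, -1 ≤ Real.exp (-2 * t) * s ∧ Real.exp (-2 * t) * s ≤ 1 := by
    intro s
    have h1 : Tendsto (fun t : ℝ => Real.exp (-2 * t) * s) atTop (𝓝 (0 * s)) := by
      refine Tendsto.mul_const s ?_
      refine Real.tendsto_exp_atBot.comp ?_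
      exact tendsto_id.const_mul_atTop_of_neg (by norm_num)
    rw [zero_mul] at h1
    filter_upwards [h1.eventually (lt_mem_nhds (show (-1 : ℝ) < 0 by norm_num)),
      h1.eventually (gt_mem_nhds (show (0 : ℝ) < 1 by norm_num))] with t h2 h3
    exact ⟨h2.le, h3.le⟩
  obtain ⟨C, hC⟩ := hbL
  have hcomm : ∀ t s x, R (A t) (R (lm s) x) = R (lm (Real.exp (-2 * t) * s)) (R (A t) x) := by
    intro t s x
    rw [← Rm, ← Rm, A_lm A hA]
  have hLm : ∀ s, ∀ m ∈ Vm, R (lm s) m ∈ Vm := by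
    intro s m hm
    rw [hVm] at hm ⊢
    rw [tendsto_zero_iff_norm_tendsto_zero] at hm ⊢
    have h3 := hm.const_mul C
    rw [mul_zero] at h3
    refine squeeze_zero' (Eventually.of_forall fun t => norm_nonneg _) ?_ h3
    filter_upwards [hs1 s] with t ht
    rw [hcomm]
    refine ((R (lm _)).le_opNorm _).trans ?_
    exact mul_le_mul_of_nonneg_right (hC _ ht.1 ht.2) (norm_nonneg _)
  have hTm : ∀ t, ∀ m ∈ Vm, R (A t) m ∈ Vm := by
    intro t m hm
    rw [hVm] at hm ⊢
    have h1 : Tendsto (fun s => R (A t) (R (A s) m)) atTop (𝓝 (R (A t) 0)) :=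
      ((R (A t)).continuous.tendsto 0).comp hm
    rw [map_zero] at h1
    refine h1.congr fun s => ?_
    rw [← Rm, ← Rm, ← A_add A hA, ← A_add A hA, add_comm]
  have hLz : ∀ s, ∀ z ∈ V0, R (lm s) z ∈ Vm ⊔ V0 := by
    intro s z hz
    obtain ⟨p, hp, m, hm, h⟩ := hdec (R (lm s) z)
    have hp0 : p = 0 := by
      refine hK p hp (C * ‖z‖ + ‖q0 (R (lm s) z)‖ + 1) ?_
      have hm' := ((hVm m).1 hm).norm
      rw [norm_zero] at hm'
      filter_upwards [hs1 s, hm'.eventually (gt_mem_nhds one_pos)] with t ht ht'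
      have h2 : R (A t) p = R (lm (Real.exp (-2 * t) * s)) z - q0 (R (lm s) z) - R (A t) m := by
        have h3 := hcomm t s z
        rw [(hV0 z).1 hz] at h3
        rw [← h3]
        conv_rhs => enter [1, 1]; rw [h]
        rw [map_add, map_add, (hV0 _).1 (hq0 _).1]
        abel
      rw [h2]
      have h4 : ‖R (lm (Real.exp (-2 * t) * s)) z‖ ≤ C * ‖z‖ :=
        ((R (lm _)).le_opNorm _).trans
          (mul_le_mul_of_nonneg_right (hC _ ht.1 ht.2) (norm_nonneg _))
      have h5 := norm_sub_le (R (lm (Real.exp (-2 * t) * s)) z - q0 (R (lm s) z)) (R (A t) m)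
      have h6 := norm_sub_le (R (lm (Real.exp (-2 * t) * s)) z) (q0 (R (lm s) z))
      linarith
    rw [h, hp0, add_zero]
    exact add_mem (Submodule.mem_sup_right (hq0 _).1) (Submodule.mem_sup_left hm)
  have hqm : ∀ x y : V, y ∈ Vm → q0 (x + y) = q0 x := by
    intro x y hy
    have := hq 0 (zero_mem _) y hy
    rw [zero_add] at this
    rw [map_add, this, add_zero]
  have hqT : ∀ t, ∀ y ∈ Vm ⊔ V0, q0 (R (A t) y) = q0 y := by
    intro t y hy
    have h1 : R (A t) y = q0 y + R (A t) (y - q0 y) := by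
      rw [map_sub, (hV0 _).1 (hq0 _).1]; abel
    rw [h1]
    exact hq _ (hq0 _).1 _ (hTm _ _ (hW y hy))
  have hLq : ∀ s, ∀ z ∈ V0, q0 (R (lm s) z) = z := by
    intro s z hz
    have h2 : q0 (R (lm (s + s)) z) = q0 (R (lm s) z) := by
      have h3 := hcomm (-(Real.log 2 / 2)) s z
      rw [(hV0 z).1 hz, show -2 * -(Real.log 2 / 2) = Real.log 2 by ring,
        Real.exp_log two_pos, two_mul] at h3
      rw [← h3]
      exact hqT _ _ (hLz s z hz)
    set Z := q0 (R (lm s) z) with hZ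
    have hZ0 : Z ∈ V0 := (hq0 _).1
    have h3 : q0 (R (lm s) Z) = Z := by
      have h4 : R (lm (s + s)) z = R (lm s) Z + R (lm s) (R (lm s) z - Z) := by
        rw [lm_add, Rm, ← map_add]; congr 1; abel
      rw [h4, hqm _ _ (hLm _ _ (hW _ (hLz s z hz)))] at h2
      exact h2
    have h5 : R (lm s) (Z - z) ∈ Vm := by
      have h6 := hW _ (hLz s (Z - z) (sub_mem hZ0 hz))
      rw [map_sub (R (lm s)), map_sub q0, h3, ← hZ, sub_self, sub_zero] at h6
      rw [map_sub]; exact h6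
    have h7 := hLm (-s) _ h5
    rw [← Rm, ← lm_add, neg_add_cancel, lm_zero, R1] at h7
    exact sub_eq_zero.1 (h0m _ (sub_mem hZ0 hz) h7)
  have hLW : ∀ s, ∀ x ∈ Vm ⊔ V0, R (lm s) x ∈ Vm ⊔ V0 ∧ q0 (R (lm s) x) = q0 x := by
    intro s x hx
    have h1 : R (lm s) x = R (lm s) (q0 x) + R (lm s) (x - q0 x) := by
      rw [← map_add]; congr 1; abel
    have h2 := hLm s _ (hW x hx)
    rw [h1]
    exact ⟨add_mem (hLz s _ (hq0 x).1) (Submodule.mem_sup_left h2), by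
      rw [hqm _ _ h2, hLq _ _ (hq0 x).1]⟩
  -- action of em
  have hem0 : ∀ z ∈ V0, R em z ∈ V0 := by
    intro z hz
    rw [hV0]
    intro t
    rw [← Rm, A_em A hA, Rm, (hV0 z).1 hz]
  have hemm : ∀ m ∈ Vm, R em m ∈ Vp := by
    intro m hm
    rw [hVm] at hm
    rw [hVp]
    have h1 : Tendsto (fun t => R em (R (A (-t)) m)) atBot (𝓝 (R em 0)) :=
      ((R em).continuous.tendsto 0).comp (hm.comp tendsto_neg_atBot_atTop)
    rw [map_zero] at h1
    refine h1.congr fun s => ?_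
    rw [← Rm, ← Rm, A_em A hA]
  -- conclusion
  obtain ⟨g, hg, hg0, hgW⟩ : ∃ g : G, um r = lm r⁻¹ * (g * em) * lm r⁻¹ ∧
      (∀ z ∈ V0, R g z = z) ∧ (∀ m ∈ Vp, R g m ∈ Vp) := by
    have hTp : ∀ (h : G) , (∀ t, A t * h = h * A t) → ∀ m ∈ Vp, R h m ∈ Vp := by
      intro h hh m hm
      rw [hVp] at hm ⊢
      have h1 : Tendsto (fun s => R h (R (A s) m)) atBot (𝓝 (R h 0)) :=
        ((R h).continuous.tendsto 0).comp hm
      rw [map_zero] at h1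
      refine h1.congr fun s => ?_
      rw [← Rm, ← Rm, hh]
    rcases lt_or_gt_of_ne hr with h | h
    · refine ⟨A (Real.log (-r)) * nm, um_negr A hA r h, fun z hz => ?_, hTp _ fun t => ?_⟩
      · rw [Rm, hneg z hz, (hV0 z).1 hz]
      · rw [← mul_assoc, ← A_add A hA, mul_assoc, ← A_nm A hA t, ← mul_assoc, ← A_add A hA,
          add_comm]
    · refine ⟨A (Real.log r), um_pos A hA r h, fun z hz => (hV0 z).1 hz _, hTp _ fun t => ?_⟩
      rw [← A_add A hA, ← A_add A hA, add_comm]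
  set w := R (lm r⁻¹) v with hw
  obtain ⟨hwW, hwq⟩ := hLW r⁻¹ v hv
  rw [← hw] at hwW hwq
  have h1 : R (um r) v = R (lm r⁻¹) (R (g * em) w) := by rw [hg, Rm, Rm]
  have h2 : R (g * em) w = R (lm (-r⁻¹)) (R (um r) v) := by
    rw [h1, ← Rm (lm (-r⁻¹)), ← lm_add, neg_add_cancel, lm_zero, R1]
  have h3 : R (g * em) w ∈ Vm ⊔ V0 := by rw [h2]; exact (hLW _ _ hv').1
  have h4 : q0 (R (um r) v) = q0 (R (g * em) w) := by rw [h2]; exact (hLW _ _ hv').2.symm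
  have h5 : R (g * em) w = R em (q0 w) + R (g * em) (w - q0 w) := by
    rw [map_sub, Rm g em (q0 w), hg0 _ (hem0 _ (hq0 w).1)]; abel
  have h6 : R (g * em) (w - q0 w) ∈ Vp := by
    rw [Rm]; exact hgW _ (hemm _ (hW w hwW))
  have h7 : R (g * em) (w - q0 w) = 0 := by
    refine hpW _ h6 ?_
    have : R (g * em) (w - q0 w) = R (g * em) w - R em (q0 w) := by rw [h5]; abel
    rw [this]
    exact sub_mem h3 (Submodule.mem_sup_right (hem0 _ (hq0 w).1))
  rw [h4, h5, h7, hqm _ _ (zero_mem _), hwq]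
  have := hq _ (hem0 _ (hq0 v).1) 0 (zero_mem _)
  rwa [add_zero] at this

end SL2Aux

open Filter Topology

/-- Basic `SL(2,ℝ)` lemma: with `V⁺, V⁰, V⁻` the expanding, fixed and contracting
subspaces of the diagonal flow `a_t = diag(eᵗ, e⁻ᵗ)` in a finite-dimensional real
representation `ρ` of `SL(2,ℝ)`, if `v ∈ V⁻ + V⁰` and `ρ(u_r) v ∈ V⁻ + V⁰` for some
`r ≠ 0` (`u_r = [[1,r],[0,1]]`), then `q⁰(ρ(u_r) v) = ρ(E) q⁰(v)` with `E = [[0,1],[-1,0]]`. -/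
theorem sl2_basic_lemma_qzero
    (V : Type*) [NormedAddCommGroup V] [NormedSpace ℝ V] [FiniteDimensional ℝ V]
    (ρ : Matrix.SpecialLinearGroup (Fin 2) ℝ →* (V →ₗ[ℝ] V)ˣ)
    (A : ℝ → Matrix.SpecialLinearGroup (Fin 2) ℝ)
    (hA : ∀ t : ℝ, (A t : Matrix (Fin 2) (Fin 2) ℝ) =
      !![Real.exp t, 0; 0, Real.exp (-t)])
    (Vp V0 Vm : Submodule ℝ V)
    (hVp : ∀ v : V, v ∈ Vp ↔
      Tendsto (fun t : ℝ => (ρ (A t) : V →ₗ[ℝ] V) v) atBot (𝓝 0))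
    (hV0 : ∀ v : V, v ∈ V0 ↔ ∀ t : ℝ, (ρ (A t) : V →ₗ[ℝ] V) v = v)
    (hVm : ∀ v : V, v ∈ Vm ↔
      Tendsto (fun t : ℝ => (ρ (A t) : V →ₗ[ℝ] V) v) atTop (𝓝 0))
    (q0 : V →ₗ[ℝ] V)
    (hq0 : ∀ v : V, q0 v ∈ V0 ∧ v - q0 v ∈ Vp ⊔ Vm)
    (v : V) (hv : v ∈ Vm ⊔ V0) (r : ℝ) (hr : r ≠ 0)
    (hv' : (ρ ⟨!![1, r; 0, 1], by simp [Matrix.det_fin_two_of]⟩ : V →ₗ[ℝ] V) v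
      ∈ Vm ⊔ V0) :
    q0 ((ρ ⟨!![1, r; 0, 1], by simp [Matrix.det_fin_two_of]⟩ : V →ₗ[ℝ] V) v) =
      (ρ ⟨!![0, 1; -1, 0], by simp [Matrix.det_fin_two_of]⟩ : V →ₗ[ℝ] V) (q0 v) := by
  let R : Matrix.SpecialLinearGroup (Fin 2) ℝ →* (V →L[ℝ] V) :=
    ((Module.End.toContinuousLinearMap (𝕜 := ℝ) V : (V →ₗ[ℝ] V) →* (V →L[ℝ] V)).comp
      (Units.coeHom (V →ₗ[ℝ] V))).comp ρ
  exact SL2Aux.main_aux R A hA Vp V0 Vm hVp hV0 hVm q0 hq0 v hv r hr hv'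
end
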